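/- Let e : ℝ → ℝ be any map and define the Q-Bellman operator 𝔉^e on functions q : S × ℝ × A → ℝ by 𝔉^e q(s,z,a) := min(0, r(s,a)+z) − min(0, z) + γ · Σ_{s' ∈ S} P(s'|s,a) · max_{a' ∈ A} q(s', p(e((r(s,a)+z)/γ)), a'). Then: (i) 𝔉^e is a γ-contraction in sup-norm (if |q₁(x) − q₂(x)| ≤ C for all x with C ≥ 0, then |𝔉^e q₁(x) − 𝔉^e q₂(x)| ≤ γ·C for all x); (ii) 𝔉^e has exactly one bounded fixed point q*; (iii) for every bounded q : S × ℝ × A → ℝ and every ε ≥ 0 such that |𝔉^e q(x) − q(x)| ≤ ε for all x ∈ S × ℝ × A, one has |q*(x) − 𝔉^e q(x)| ≤ γ·ε/(1−γ) for all x. -/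

import Mathlib

/-- The clamp `p(x) = max (−c) (min x c)`. -/
noncomputable def clampP (c : ℝ) (x : ℝ) : ℝ := max (-c) (min x c)

/-- The Q-Bellman operator
`𝔉^e q (s, z, a) = min 0 (r s a + z) - min 0 z
  + γ * Σ_{s'} P(s'|s,a) * max_{a'} q (s', p (e ((r s a + z)/γ)), a')`. -/
noncomputable def Fq {S A : Type*} [Fintype S] [Fintype A] [Nonempty A]
    (P : S → A → PMF S) (r : S → A → ℝ) (γ rγ : ℝ) (e : ℝ → ℝ)
    (q : S × ℝ × A → ℝ) : S × ℝ × A → ℝ :=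
  fun x => min 0 (r x.1 x.2.2 + x.2.1) - min 0 x.2.1
    + γ * ∑ s' : S, ((P x.1 x.2.2) s').toReal *
        (Finset.univ.sup' Finset.univ_nonempty fun a' =>
          q (s', clampP rγ (e ((r x.1 x.2.2 + x.2.1) / γ)), a'))

/-- Finite maxima are nonexpansive in the sup norm. -/
theorem abs_finset_sup_sub_le {ι : Type*} {s : Finset ι} (hs : s.Nonempty) {f g : ι → ℝ} {C : ℝ}
    (h : ∀ i ∈ s, |f i - g i| ≤ C) : |s.sup' hs f - s.sup' hs g| ≤ C := by
  rw [abs_sub_le_iff, sub_le_iff_le_add, sub_le_iff_le_add]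
  constructor <;> refine Finset.sup'_le hs _ fun i hi => ?_
  · linarith [(abs_sub_le_iff.1 (h i hi)).1, Finset.le_sup' g hi]
  · linarith [(abs_sub_le_iff.1 (h i hi)).2, Finset.le_sup' f hi]

theorem PMF.sum_toReal_eq_one {α : Type*} [Fintype α] (p : PMF α) : ∑ a, (p a).toReal = 1 := by
  rw [← ENNReal.toReal_sum fun a _ => p.apply_ne_top a, ← tsum_fintype (L := .unconditional α),
    p.tsum_coe, ENNReal.toReal_one]

/-- Expectations under a distribution on a finite type are nonexpansive in the sup norm. -/
theorem PMF.abs_sum_mul_sub_sum_mul_le {α : Type*} [Fintype α] (p : PMF α) {f g : α → ℝ} {C : ℝ}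
    (h : ∀ a, |f a - g a| ≤ C) :
    |∑ a, (p a).toReal * f a - ∑ a, (p a).toReal * g a| ≤ C := by
  rw [← Finset.sum_sub_distrib]
  calc |∑ a, ((p a).toReal * f a - (p a).toReal * g a)|
      ≤ ∑ a, |(p a).toReal * f a - (p a).toReal * g a| := Finset.abs_sum_le_sum_abs _ _
    _ ≤ ∑ a, (p a).toReal * C := by
        refine Finset.sum_le_sum fun a _ => ?_
        rw [← mul_sub, abs_mul, abs_of_nonneg ENNReal.toReal_nonneg]
        exact mul_le_mul_of_nonneg_left (h a) ENNReal.toReal_nonneg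
    _ = C := by rw [← Finset.sum_mul, p.sum_toReal_eq_one, one_mul]

/-- The Q-Bellman operator contracts sup-norm distances by the factor `γ`. -/
theorem abs_Fq_sub_Fq_le {S A : Type*} [Fintype S] [Fintype A] [Nonempty A]
    (P : S → A → PMF S) (r : S → A → ℝ) {γ : ℝ} (hγ : 0 ≤ γ) (c : ℝ) (e : ℝ → ℝ)
    {q₁ q₂ : S × ℝ × A → ℝ} {C : ℝ} (h : ∀ x, |q₁ x - q₂ x| ≤ C) (x : S × ℝ × A) :
    |Fq P r γ c e q₁ x - Fq P r γ c e q₂ x| ≤ γ * C := by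
  unfold Fq
  rw [add_sub_add_left_eq_sub, ← mul_sub, abs_mul, abs_of_nonneg hγ]
  exact mul_le_mul_of_nonneg_left ((P x.1 x.2.2).abs_sum_mul_sub_sum_mul_le fun s' =>
    abs_finset_sup_sub_le _ fun a' _ => h _) hγ

/-- The Q-Bellman operator sends the zero function to a function bounded by the reward bound. -/
theorem abs_Fq_zero_le {S A : Type*} [Fintype S] [Fintype A] [Nonempty A]
    (P : S → A → PMF S) (r : S → A → ℝ) {R : ℝ} (hr : ∀ s a, |r s a| ≤ R) (γ c : ℝ) (e : ℝ → ℝ)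
    (x : S × ℝ × A) : |Fq P r γ c e 0 x| ≤ R := by
  have h := abs_min_sub_min_le_max 0 (r x.1 x.2.2 + x.2.1) 0 x.2.1
  rw [sub_self, abs_zero, add_sub_cancel_right, max_eq_right (abs_nonneg _)] at h
  simpa [Fq] using h.trans (hr x.1 x.2.2)

section SupNormContraction

variable {X : Type*} {F : (X → ℝ) → X → ℝ} {γ : ℝ}

/-- A sup-norm contraction that maps zero to a bounded function has a bounded fixed point. -/
theorem exists_bounded_fixedPoint (hγ₀ : 0 ≤ γ) (hγ₁ : γ < 1)
    (hF : ∀ (f g : X → ℝ) (C : ℝ), 0 ≤ C → (∀ x, |f x - g x| ≤ C) → ∀ x, |F f x - F g x| ≤ γ * C)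
    {R : ℝ} (hR : ∀ x, |F 0 x| ≤ R) :
    ∃ f : X → ℝ, (∃ M : ℝ, ∀ x, |f x| ≤ M) ∧ F f = f := by
  let _ : TopologicalSpace X := ⊥
  have : DiscreteTopology X := ⟨rfl⟩
  have hb (f : BoundedContinuousFunction X ℝ) (x : X) : ‖F f x‖ ≤ γ * ‖f‖ + R := by
    have h := hF f 0 ‖f‖ (norm_nonneg f) (fun y => by simpa using f.norm_coe_le_norm y) x
    have h' := abs_add_le (F f x - F 0 x) (F 0 x)
    rw [sub_add_cancel] at h'
    rw [Real.norm_eq_abs]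
    linarith [hR x]
  let G (f : BoundedContinuousFunction X ℝ) : BoundedContinuousFunction X ℝ :=
    BoundedContinuousFunction.ofNormedAddCommGroupDiscrete (F f) (γ * ‖f‖ + R) (hb f)
  have hG : ContractingWith ⟨γ, hγ₀⟩ G := by
    refine ⟨hγ₁, LipschitzWith.of_dist_le_mul fun f g => ?_⟩
    exact (BoundedContinuousFunction.dist_le (mul_nonneg hγ₀ dist_nonneg)).2
      (hF f g (dist f g) dist_nonneg fun y => f.dist_coe_le_dist (g := g) y)
  obtain ⟨f, hf⟩ : ∃ f, G f = f := ⟨_, hG.fixedPoint_isFixedPt⟩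
  exact ⟨f, ⟨_, f.norm_coe_le_norm⟩, congrArg DFunLike.coe hf⟩

/-- The distance from a bounded function to a bounded fixed point of a sup-norm contraction is
controlled by the residual of that function. -/
theorem abs_fixedPoint_sub_le (hγ₁ : γ < 1)
    (hF : ∀ (f g : X → ℝ) (C : ℝ), 0 ≤ C → (∀ x, |f x - g x| ≤ C) → ∀ x, |F f x - F g x| ≤ γ * C)
    {f g : X → ℝ} (hf : ∃ M : ℝ, ∀ x, |f x| ≤ M) (hfix : F f = f) (hg : ∃ M : ℝ, ∀ x, |g x| ≤ M)
    {ε : ℝ} (hε : ∀ x, |F g x - g x| ≤ ε) (x : X) : |f x - g x| ≤ ε / (1 - γ) := by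
  obtain ⟨M, hM⟩ := hf
  obtain ⟨N, hN⟩ := hg
  have : Nonempty X := ⟨x⟩
  have hbdd : BddAbove (Set.range fun y => |f y - g y|) := by
    refine ⟨M + N, ?_⟩
    rintro _ ⟨y, rfl⟩
    exact (abs_sub _ _).trans (add_le_add (hM y) (hN y))
  have hle (y : X) : |f y - g y| ≤ ⨆ z, |f z - g z| := le_ciSup hbdd y
  have hsup : ⨆ y, |f y - g y| ≤ γ * (⨆ y, |f y - g y|) + ε := by
    refine ciSup_le fun y => (abs_sub_le (f y) (F g y) (g y)).trans (add_le_add ?_ (hε y))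
    simpa only [hfix] using hF f g _ ((abs_nonneg _).trans (hle x)) hle y
  rw [le_div_iff₀ (sub_pos.2 hγ₁)]
  calc |f x - g x| * (1 - γ) ≤ (⨆ y, |f y - g y|) * (1 - γ) :=
        mul_le_mul_of_nonneg_right (hle x) (sub_pos.2 hγ₁).le
    _ ≤ ε := by linarith

end SupNormContraction

/-- the Q-Bellman operator `𝔉^e` is (i) a `γ`-contraction in sup-norm,
(ii) has exactly one bounded fixed point `q*`, and (iii) if `|𝔉^e q − q| ≤ ε` pointwise for a
bounded `q` then `|q* − 𝔉^e q| ≤ γ·ε/(1−γ)` pointwise. -/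
theorem Fq_contraction_fixedPoint_error
    {S A : Type*} [Fintype S] [Nonempty S] [Fintype A] [Nonempty A]
    (P : S → A → PMF S) (r : S → A → ℝ) (r_max : ℝ) (hr_max : 0 < r_max)
    (hr : ∀ s a, |r s a| ≤ r_max) (γ : ℝ) (hγ : γ ∈ Set.Ioo (0 : ℝ) 1)
    (e : ℝ → ℝ) :
    (∀ (q₁ q₂ : S × ℝ × A → ℝ) (C : ℝ), 0 ≤ C → (∀ x, |q₁ x - q₂ x| ≤ C) →
      ∀ x, |Fq P r γ (r_max / (1 - γ)) e q₁ x - Fq P r γ (r_max / (1 - γ)) e q₂ x| ≤ γ * C) ∧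
    (∃! qstar : S × ℝ × A → ℝ,
      (∃ M : ℝ, ∀ x, |qstar x| ≤ M) ∧ Fq P r γ (r_max / (1 - γ)) e qstar = qstar) ∧
    (∀ qstar : S × ℝ × A → ℝ, (∃ M : ℝ, ∀ x, |qstar x| ≤ M) →
      Fq P r γ (r_max / (1 - γ)) e qstar = qstar →
      ∀ (q : S × ℝ × A → ℝ), (∃ M : ℝ, ∀ x, |q x| ≤ M) →
      ∀ ε : ℝ, 0 ≤ ε → (∀ x, |Fq P r γ (r_max / (1 - γ)) e q x - q x| ≤ ε) →
      ∀ x, |qstar x - Fq P r γ (r_max / (1 - γ)) e q x| ≤ γ * ε / (1 - γ)) := by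
  have hF (q₁ q₂ : S × ℝ × A → ℝ) (C : ℝ) (_ : 0 ≤ C) (h : ∀ x, |q₁ x - q₂ x| ≤ C) (x) :
      |Fq P r γ (r_max / (1 - γ)) e q₁ x - Fq P r γ (r_max / (1 - γ)) e q₂ x| ≤ γ * C :=
    abs_Fq_sub_Fq_le P r hγ.1.le _ e h x
  refine ⟨hF, ?_, fun qstar hb hfix q hq ε hε h x => ?_⟩
  · obtain ⟨q, hq, hfix⟩ :=
      exists_bounded_fixedPoint hγ.1.le hγ.2 hF (abs_Fq_zero_le P r hr γ (r_max / (1 - γ)) e)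
    refine ⟨q, ⟨hq, hfix⟩, fun q' ⟨hq', hfix'⟩ => funext fun x => ?_⟩
    have h := abs_fixedPoint_sub_le hγ.2 hF hq' hfix' hq (ε := 0) (fun y => by simp [hfix]) x
    rw [zero_div] at h
    exact sub_eq_zero.1 (abs_nonpos_iff.1 h)
  · have hd := hF qstar q (ε / (1 - γ)) (div_nonneg hε (sub_pos.2 hγ.2).le)
      (abs_fixedPoint_sub_le hγ.2 hF hb hfix hq h) x
    rwa [hfix, ← mul_div_assoc] at hd
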